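/- (Shalom) Let n ≥ 4 and let H be the subgroup of SL(n,ℂ) consisting of block matrices diag(A, I_{n−2}) with A ∈ SL(2,ℂ), i.e., SL(2,ℂ) embedded in the upper-left corner. Then there is no discrete subgroup Γ of SL(n,ℂ) whose action by left multiplication on the coset space SL(n,ℂ)/H is free, properly discontinuous and cocompact; i.e., SL(2,ℂ)\SL(n,ℂ) admits no compact Clifford–Klein form for n ≥ 4. -/

import Mathlib

open Matrix

/-- The matrix topology on `SL(n, ℂ)`, induced from the space of matrices. -/
noncomputable instance (n : ℕ) : TopologicalSpace (Matrix.SpecialLinearGroup (Fin n) ℂ) :=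
  TopologicalSpace.induced (fun g => (g : Matrix (Fin n) (Fin n) ℂ)) inferInstance


namespace Shalom

abbrev S := Matrix.SpecialLinearGroup (Fin 2) ℂ

noncomputable def al (h : S) : ℝ := ‖h.1 0 0‖^2 + ‖h.1 0 1‖^2
noncomputable def de (h : S) : ℝ := ‖h.1 1 0‖^2 + ‖h.1 1 1‖^2
noncomputable def M (h : S) : ℝ := al h + de h

lemma det_eq (h : S) : h.1 0 0 * h.1 1 1 - h.1 0 1 * h.1 1 0 = 1 := by
  have := h.2
  rw [Matrix.det_fin_two] at this
  exact this

lemma al_nonneg (h : S) : 0 ≤ al h := by unfold al; positivity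
lemma de_nonneg (h : S) : 0 ≤ de h := by unfold de; positivity

lemma mul_entry (g k : S) (i j : Fin 2) : (g * k).1 i j = g.1 i 0 * k.1 0 j + g.1 i 1 * k.1 1 j := by
  simp [Matrix.SpecialLinearGroup.coe_mul, Matrix.mul_apply, Fin.sum_univ_two]

lemma inv_val (g : S) : (g⁻¹).1 = !![g.1 1 1, -g.1 0 1; -g.1 1 0, g.1 0 0] := by
  simp [Matrix.SpecialLinearGroup.coe_inv, Matrix.adjugate_fin_two]

lemma cs2 (a b c d : ℂ) : ‖a * c + b * d‖^2 ≤ (‖a‖^2 + ‖b‖^2) * (‖c‖^2 + ‖d‖^2) := by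
  have h1 : ‖a * c + b * d‖ ≤ ‖a‖ * ‖c‖ + ‖b‖ * ‖d‖ := by
    refine (norm_add_le _ _).trans ?_
    simp
  have h2 : ‖a * c + b * d‖^2 ≤ (‖a‖ * ‖c‖ + ‖b‖ * ‖d‖)^2 := by gcongr
  nlinarith [sq_nonneg (‖a‖ * ‖d‖ - ‖b‖ * ‖c‖)]

lemma al_mul_le (g k : S) : al (g * k) ≤ al g * M k := by
  unfold M al de
  rw [mul_entry, mul_entry]
  have h1 := cs2 (g.1 0 0) (g.1 0 1) (k.1 0 0) (k.1 1 0)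
  have h2 := cs2 (g.1 0 0) (g.1 0 1) (k.1 0 1) (k.1 1 1)
  nlinarith

lemma de_mul_le (g k : S) : de (g * k) ≤ de g * M k := by
  unfold M al de
  rw [mul_entry, mul_entry]
  have h1 := cs2 (g.1 1 0) (g.1 1 1) (k.1 0 0) (k.1 1 0)
  have h2 := cs2 (g.1 1 0) (g.1 1 1) (k.1 0 1) (k.1 1 1)
  nlinarith

lemma M_mul_le (g k : S) : M (g * k) ≤ M g * M k := by
  calc M (g * k) = al (g * k) + de (g * k) := rfl
    _ ≤ al g * M k + de g * M k := add_le_add (al_mul_le g k) (de_mul_le g k)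
    _ = M g * M k := (add_mul _ _ _).symm

lemma M_inv (g : S) : M g⁻¹ = M g := by
  unfold M al de
  rw [inv_val]
  simp
  ring

lemma one_le_w (g : S) : 1 ≤ al g * de g := by
  have h := cs2 (g.1 0 0) (g.1 0 1) (g.1 1 1) (- g.1 1 0)
  have e : g.1 0 0 * g.1 1 1 + g.1 0 1 * (- g.1 1 0) = 1 := by
    linear_combination det_eq g
  rw [e] at h
  simp at h
  unfold al de
  linarith

lemma al_pos (g : S) : 0 < al g := by
  have h1 := one_le_w g
  have h2 := al_nonneg g
  have h3 := de_nonneg g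
  by_contra h
  have h4 : al g = 0 := by linarith
  rw [h4, zero_mul] at h1
  linarith

lemma de_pos (g : S) : 0 < de g := by
  have h1 := one_le_w g
  have h2 := al_nonneg g
  have h3 := de_nonneg g
  by_contra h
  have h4 : de g = 0 := by linarith
  rw [h4, mul_zero] at h1
  linarith

lemma two_le_M (g : S) : 2 ≤ M g := by
  have h1 := one_le_w g
  have h2 := al_pos g
  have h3 := de_pos g
  unfold M
  nlinarith [sq_nonneg (al g - de g), sq_nonneg (al g + de g)]

lemma M_dist (g k : S) : M (g⁻¹ * k) ≤ 2 * (de g * al k + al g * de k) := by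
  have key : ∀ x y : ℂ, ‖x + y‖^2 ≤ 2 * (‖x‖^2 + ‖y‖^2) := by
    intro x y
    have h1 := norm_add_le x y
    have h2 : ‖x + y‖^2 ≤ (‖x‖ + ‖y‖)^2 := by gcongr
    nlinarith [sq_nonneg (‖x‖ - ‖y‖)]
  unfold M al de
  rw [mul_entry, mul_entry, mul_entry, mul_entry, inv_val]
  simp only [Matrix.of_apply, Matrix.cons_val', Matrix.cons_val_zero, Matrix.cons_val_one,
    Matrix.cons_val_fin_one]
  have h1 := key (g.1 1 1 * k.1 0 0) (-g.1 0 1 * k.1 1 0)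
  have h2 := key (g.1 1 1 * k.1 0 1) (-g.1 0 1 * k.1 1 1)
  have h3 := key (-g.1 1 0 * k.1 0 0) (g.1 0 0 * k.1 1 0)
  have h4 := key (-g.1 1 0 * k.1 0 1) (g.1 0 0 * k.1 1 1)
  simp only [norm_mul, norm_neg, mul_pow] at h1 h2 h3 h4
  linarith

lemma mkS (a b c d : ℂ) (h : a * d - b * c = 1) :
    ∃ k : S, k.1 0 0 = a ∧ k.1 0 1 = b ∧ k.1 1 0 = c ∧ k.1 1 1 = d :=
  ⟨⟨!![a, b; c, d], by rw [Matrix.det_fin_two]; simpa using h⟩, by simp, by simp, by simp, by simp⟩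

/-- Reduction: a large element can be shortened by a bounded one. -/
lemma reduce (h : S) (hM : 6 ≤ M h) : ∃ k : S, M k ≤ 9 ∧ M (h * k) ≤ M h / 2 := by
  -- core computation with columns
  have core : ∀ a b c d : ℂ, a * d - b * c = 1 → ‖b‖^2 + ‖d‖^2 ≤ ‖a‖^2 + ‖c‖^2 →
      6 ≤ (‖a‖^2 + ‖c‖^2) + (‖b‖^2 + ‖d‖^2) → ∃ μ : ℂ, ‖μ‖^2 ≤ 1 ∧
      (‖a/2‖^2 + ‖c/2‖^2) + (‖2*(b - μ * a)‖^2 + ‖2*(d - μ * c)‖^2) ≤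
        ((‖a‖^2 + ‖c‖^2) + (‖b‖^2 + ‖d‖^2)) / 2 := by
    intro a b c d hdet hle hbig
    set s : ℝ := ‖a‖^2 + ‖c‖^2 with hs
    set r : ℝ := ‖b‖^2 + ‖d‖^2 with hr
    have hs3 : 3 ≤ s := by linarith
    have hsne : (s : ℂ) ≠ 0 := by
      have : s ≠ 0 := by linarith
      exact_mod_cast this
    have hsc : (s : ℂ) = a * star a + c * star c := by
      rw [hs]; push_cast
      rw [← Complex.mul_conj', ← Complex.mul_conj']; rfl
    let μ : ℂ := (star a * b + star c * d) / s
    have e1 : b - μ * a = - star c / s := by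
      simp only [μ]
      field_simp
      rw [hsc]
      linear_combination (-star c) * hdet
    have e2 : d - μ * c = star a / s := by
      simp only [μ]
      field_simp
      rw [hsc]
      linear_combination (star a) * hdet
    refine ⟨μ, ?_, ?_⟩
    · have h1 : ‖star a * b + star c * d‖^2 ≤ s * r := by
        have := cs2 (star a) (star c) b d
        simpa [hs, hr] using this
      have h2 : ‖μ‖^2 = ‖star a * b + star c * d‖^2 / s^2 := by
        simp only [μ, norm_div, div_pow]
        congr 2
        rw [Complex.norm_real, Real.norm_eq_abs, abs_of_nonneg (by linarith)]
      rw [h2, div_le_one (by positivity)]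
      nlinarith
    · rw [e1, e2]
      have n1 : ‖2 * (-star c / (s:ℂ))‖^2 = 4 * ‖c‖^2 / s^2 := by
        simp [mul_pow, div_pow]
        ring
      have n2 : ‖2 * (star a / (s:ℂ))‖^2 = 4 * ‖a‖^2 / s^2 := by
        simp [mul_pow, div_pow]
        ring
      have n3 : ‖a / 2‖^2 + ‖c/2‖^2 = s / 4 := by
        simp [div_pow, hs]; ring
      rw [n1, n2, n3]
      have n4 : 4 * ‖c‖^2 / s^2 + 4 * ‖a‖^2 / s^2 = 4 / s := by
        have : s ≠ 0 := by linarith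
        have e : ‖c‖^2 = s - ‖a‖^2 := by rw [hs]; ring
        rw [e]; field_simp; ring
      rw [n4]
      have : 4 / s ≤ 4/3 := by
        apply div_le_div_of_nonneg_left <;> linarith
      have hr0 : 0 ≤ r := by rw [hr]; positivity
      have h9 : 4 / s ≤ s / 4 + r / 2 := by
        by_cases h4 : 4 ≤ s
        · have : 4 / s ≤ 1 := by rw [div_le_one] <;> linarith
          linarith
        · have : 2 ≤ r := by linarith
          linarith
      linarith
  have hdet := det_eq h
  rcases le_total (‖h.1 0 1‖^2 + ‖h.1 1 1‖^2) (‖h.1 0 0‖^2 + ‖h.1 1 0‖^2) with hle | hle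
  · obtain ⟨μ, h1, h2⟩ := core _ _ _ _ hdet hle (by unfold M al de at hM; linarith)
    obtain ⟨k, k0, k1, k2, k3⟩ := mkS (1/2) (-2*μ) 0 2 (by ring)
    refine ⟨k, ?_, ?_⟩
    · unfold M al de
      rw [k0, k1, k2, k3]
      simp [mul_pow]
      nlinarith
    · unfold M al de
      rw [mul_entry, mul_entry, mul_entry, mul_entry, k0, k1, k2, k3]
      convert_to _ ≤ ((‖h.1 0 0‖^2 + ‖h.1 1 0‖^2) + (‖h.1 0 1‖^2 + ‖h.1 1 1‖^2)) / 2
      · ring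
      refine le_trans (le_of_eq ?_) h2
      have q1 : h.1 0 0 * (1/2) + h.1 0 1 * 0 = h.1 0 0 / 2 := by ring
      have q2 : h.1 1 0 * (1/2) + h.1 1 1 * 0 = h.1 1 0 / 2 := by ring
      have q3 : h.1 0 0 * (-2*μ) + h.1 0 1 * 2 = 2 * (h.1 0 1 - μ * h.1 0 0) := by ring
      have q4 : h.1 1 0 * (-2*μ) + h.1 1 1 * 2 = 2 * (h.1 1 1 - μ * h.1 1 0) := by ring
      rw [q1, q2, q3, q4]; ring
  · obtain ⟨μ, h1, h2⟩ := core (h.1 1 1) (h.1 1 0) (h.1 0 1) (h.1 0 0)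
      (by linear_combination hdet) (by linarith) (by unfold M al de at hM; linarith)
    obtain ⟨k, k0, k1, k2, k3⟩ := mkS 2 0 (-2*μ) (1/2) (by ring)
    refine ⟨k, ?_, ?_⟩
    · unfold M al de
      rw [k0, k1, k2, k3]
      simp [mul_pow]
      nlinarith
    · unfold M al de
      rw [mul_entry, mul_entry, mul_entry, mul_entry, k0, k1, k2, k3]
      convert_to _ ≤ ((‖h.1 1 1‖^2 + ‖h.1 0 1‖^2) + (‖h.1 1 0‖^2 + ‖h.1 0 0‖^2)) / 2
      · ring
      refine le_trans (le_of_eq ?_) h2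
      have q1 : h.1 0 0 * 0 + h.1 0 1 * (1/2) = h.1 0 1 / 2 := by ring
      have q2 : h.1 1 0 * 0 + h.1 1 1 * (1/2) = h.1 1 1 / 2 := by ring
      have q3 : h.1 0 0 * 2 + h.1 0 1 * (-2*μ) = 2 * (h.1 0 0 - μ * h.1 0 1) := by ring
      have q4 : h.1 1 0 * 2 + h.1 1 1 * (-2*μ) = 2 * (h.1 1 0 - μ * h.1 1 1) := by ring
      rw [q1, q2, q3, q4]; ring

lemma mink (a b c d : ℂ) : √(‖a + c‖^2 + ‖b + d‖^2) ≤ √(‖a‖^2 + ‖b‖^2) + √(‖c‖^2 + ‖d‖^2) := by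
  have := norm_add_le (!₂[a, b] : EuclideanSpace ℂ (Fin 2)) !₂[c, d]
  simpa [EuclideanSpace.norm_eq, Fin.sum_univ_two] using this

/-- Contraction, core version on two rows. -/
lemma contr_core (p q r s : ℂ) (hdet : ‖p * s - q * r‖ = 1) (k : S)
    (hα : 0 < ‖p‖^2 + ‖q‖^2) :
    √(‖r * k.1 0 0 + s * k.1 1 0‖^2 + ‖r * k.1 0 1 + s * k.1 1 1‖^2) * √(‖p‖^2 + ‖q‖^2) ≤
      √(‖r‖^2 + ‖s‖^2) * √(‖p * k.1 0 0 + q * k.1 1 0‖^2 + ‖p * k.1 0 1 + q * k.1 1 1‖^2)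
       + √(M k) := by
  set A : ℝ := ‖p‖^2 + ‖q‖^2 with hA
  have hAc : (A : ℂ) = p * star p + q * star q := by
    rw [hA]; push_cast
    rw [← Complex.mul_conj', ← Complex.mul_conj']; rfl
  set B : ℂ := r * star p + s * star q with hB
  set D : ℂ := p * s - q * r with hD
  have hBn : ‖B‖^2 ≤ (‖r‖^2 + ‖s‖^2) * A := by
    have := cs2 r s (star p) (star q)
    rw [hB]
    simpa [hA] using this
  set x := p * k.1 0 0 + q * k.1 1 0
  set y := p * k.1 0 1 + q * k.1 1 1
  set e0 : ℂ := - D * star q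
  set e1 : ℂ := D * star p
  -- A * r = B * p + e0, A * s = B * q + e1
  have hr : A * r = B * p + e0 := by rw [hAc]; simp only [B, e0, D]; ring
  have hs : A * s = B * q + e1 := by rw [hAc]; simp only [B, e1, D]; ring
  have h1 : (A:ℂ) * (r * k.1 0 0 + s * k.1 1 0) = B * x + (e0 * k.1 0 0 + e1 * k.1 1 0) := by
    simp only [x]; linear_combination k.1 0 0 * hr + k.1 1 0 * hs
  have h2 : (A:ℂ) * (r * k.1 0 1 + s * k.1 1 1) = B * y + (e0 * k.1 0 1 + e1 * k.1 1 1) := by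
    simp only [y]; linear_combination k.1 0 1 * hr + k.1 1 1 * hs
  have h3 := mink (B * x) (B * y) (e0 * k.1 0 0 + e1 * k.1 1 0) (e0 * k.1 0 1 + e1 * k.1 1 1)
  rw [← h1, ← h2] at h3
  simp only [norm_mul, mul_pow, Complex.norm_real, Real.norm_eq_abs, sq_abs] at h3
  rw [← mul_add, ← mul_add, Real.sqrt_mul (by positivity), Real.sqrt_mul (by positivity),
    Real.sqrt_sq hα.le, Real.sqrt_sq (norm_nonneg _)] at h3
  have hE : ‖e0‖^2 + ‖e1‖^2 = A := by
    simp [e0, e1, hdet, hA]; ring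
  have h4 : √(‖e0 * k.1 0 0 + e1 * k.1 1 0‖ ^ 2 + ‖e0 * k.1 0 1 + e1 * k.1 1 1‖ ^ 2) ≤ √A * √(M k) := by
    rw [← Real.sqrt_mul hα.le]
    apply Real.sqrt_le_sqrt
    have c1 := cs2 e0 e1 (k.1 0 0) (k.1 1 0)
    have c2 := cs2 e0 e1 (k.1 0 1) (k.1 1 1)
    rw [hE] at c1 c2
    unfold M al de
    linarith
  have h5 : ‖B‖ ≤ √(‖r‖^2 + ‖s‖^2) * √A := by
    rw [← Real.sqrt_mul (by positivity)]
    exact Real.le_sqrt_of_sq_le hBn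
  have hsA : 0 < √A := Real.sqrt_pos.mpr hα
  have hAA : A = √A * √A := (Real.mul_self_sqrt hα.le).symm
  have h6 : √A * (√(‖r * k.1 0 0 + s * k.1 1 0‖^2 + ‖r * k.1 0 1 + s * k.1 1 1‖^2) * √A) ≤
     √A * (√(‖r‖^2 + ‖s‖^2) * √(‖x‖^2 + ‖y‖^2) + √(M k)) := by
    have h7 := mul_le_mul_of_nonneg_right h5 (Real.sqrt_nonneg (‖x‖^2 + ‖y‖^2))
    have h8 : A * √(‖r * k.1 0 0 + s * k.1 1 0‖^2 + ‖r * k.1 0 1 + s * k.1 1 1‖^2) =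
      √A * (√(‖r * k.1 0 0 + s * k.1 1 0‖^2 + ‖r * k.1 0 1 + s * k.1 1 1‖^2) * √A) := by
      conv_lhs => rw [hAA]
      ring
    rw [← h8]
    linarith
  exact le_of_mul_le_mul_left h6 hsA

end Shalom

namespace Shalom

/-- logarithm of the ratio of row norms -/
noncomputable def Lr (g : S) : ℝ := Real.log (al g) - Real.log (de g)
/-- logarithm of the product of row norms -/
noncomputable def Wl (g : S) : ℝ := Real.log (al g) + Real.log (de g)

lemma Wl_nonneg (g : S) : 0 ≤ Wl g := by
  unfold Wl
  rw [← Real.log_mul (al_pos g).ne' (de_pos g).ne']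
  exact Real.log_nonneg (one_le_w g)

lemma al_eq (g : S) : al g = Real.exp ((Wl g + Lr g) / 2) := by
  have : (Wl g + Lr g) / 2 = Real.log (al g) := by unfold Wl Lr; ring
  rw [this, Real.exp_log (al_pos g)]

lemma de_eq (g : S) : de g = Real.exp ((Wl g - Lr g) / 2) := by
  have : (Wl g - Lr g) / 2 = Real.log (de g) := by unfold Wl Lr; ring
  rw [this, Real.exp_log (de_pos g)]

lemma M_pos (g : S) : 0 < M g := by linarith [two_le_M g]

lemma Wl_mul_le (g k : S) : Wl (g * k) ≤ Wl g + 2 * Real.log (M k) := by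
  have h1 := Real.log_le_log (al_pos _) (al_mul_le g k)
  have h2 := Real.log_le_log (de_pos _) (de_mul_le g k)
  rw [Real.log_mul (al_pos g).ne' (M_pos k).ne'] at h1
  rw [Real.log_mul (de_pos g).ne' (M_pos k).ne'] at h2
  unfold Wl
  linarith

lemma logM_dist (g k : S) :
    Real.log (M (g⁻¹ * k)) ≤ Real.log 4 + (Wl g + Wl k) / 2 + |Lr g - Lr k| / 2 := by
  have h := M_dist g k
  rw [al_eq g, al_eq k, de_eq g, de_eq k, ← Real.exp_add, ← Real.exp_add] at h
  have h1 : Real.exp ((Wl g - Lr g) / 2 + (Wl k + Lr k) / 2) ≤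
      Real.exp ((Wl g + Wl k) / 2 + |Lr g - Lr k| / 2) := by
    apply Real.exp_le_exp.mpr
    linarith [neg_abs_le (Lr g - Lr k)]
  have h2 : Real.exp ((Wl g + Lr g) / 2 + (Wl k - Lr k) / 2) ≤
      Real.exp ((Wl g + Wl k) / 2 + |Lr g - Lr k| / 2) := by
    apply Real.exp_le_exp.mpr
    linarith [le_abs_self (Lr g - Lr k)]
  have h3 : M (g⁻¹ * k) ≤ 4 * Real.exp ((Wl g + Wl k) / 2 + |Lr g - Lr k| / 2) := by linarith
  have h4 := Real.log_le_log (M_pos _) h3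
  rw [Real.log_mul (by norm_num) (Real.exp_pos _).ne', Real.log_exp] at h4
  linarith

lemma contr1 (g k : S) :
    √(de (g * k)) * √(al g) ≤ √(de g) * √(al (g * k)) + √(M k) := by
  have h := contr_core (g.1 0 0) (g.1 0 1) (g.1 1 0) (g.1 1 1) (by rw [det_eq]; simp) k
    (by have := al_pos g; unfold al at this; exact this)
  unfold de al
  rw [mul_entry, mul_entry, mul_entry, mul_entry]
  exact h

lemma contr2 (g k : S) :
    √(al (g * k)) * √(de g) ≤ √(al g) * √(de (g * k)) + √(M k) := by
  have h := contr_core (g.1 1 0) (g.1 1 1) (g.1 0 0) (g.1 0 1)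
    (by
      have : g.1 1 0 * g.1 0 1 - g.1 1 1 * g.1 0 0 = -1 := by linear_combination - det_eq g
      rw [this]; simp) k
    (by have := de_pos g; unfold de at this; exact this)
  unfold de al
  rw [mul_entry, mul_entry, mul_entry, mul_entry]
  exact h


lemma contr (g k : S) : |Lr (g * k) - Lr g| ≤ 2 * M k * Real.exp (-(Wl g) / 2) := by
  have c1 := contr1 g k
  have c2 := contr2 g k
  have e : ∀ x : ℝ, √(Real.exp x) = Real.exp (x / 2) := fun x => by rw [Real.exp_half]
  have a1 : al g ≤ al (g * k) * M k := by
    have := al_mul_le (g * k) k⁻¹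
    rwa [mul_inv_cancel_right, M_inv] at this
  have d1 : de g ≤ de (g * k) * M k := by
    have := de_mul_le (g * k) k⁻¹
    rwa [mul_inv_cancel_right, M_inv] at this
  have hM := M_pos k
  set μ := Real.log (M k) with hμ
  have hMe : M k = Real.exp μ := by rw [hμ, Real.exp_log hM]
  rw [al_eq g, al_eq (g*k), hMe, ← Real.exp_add, Real.exp_le_exp] at a1
  rw [de_eq g, de_eq (g*k), hMe, ← Real.exp_add, Real.exp_le_exp] at d1
  rw [al_eq g, al_eq (g*k), de_eq g, de_eq (g*k), hMe, e, e, e, e, e,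
    ← Real.exp_add, ← Real.exp_add] at c1 c2
  rw [hMe]
  set w := Wl g
  set w' := Wl (g*k)
  set l := Lr g
  set l' := Lr (g*k)
  have key : ∀ A B C : ℝ, Real.exp A ≤ Real.exp B + Real.exp C → A - B ≤ Real.exp (C - B) := by
    intro A B C h
    have h1 : Real.exp (A - B) ≤ 1 + Real.exp (C - B) := by
      rw [Real.exp_sub, Real.exp_sub, div_le_iff₀ (Real.exp_pos B)]
      have : Real.exp B ≠ 0 := (Real.exp_pos B).ne'
      field_simp
      linarith
    linarith [Real.add_one_le_exp (A - B)]
  have k1 := key _ _ _ c1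
  have k2 := key _ _ _ c2
  have f1 : Real.exp (μ / 2 - ((w - l) / 2 / 2 + (w' + l') / 2 / 2)) ≤ Real.exp (μ + -w/2) := by
    apply Real.exp_le_exp.mpr
    linarith
  have f2 : Real.exp (μ / 2 - ((w + l) / 2 / 2 + (w' - l') / 2 / 2)) ≤ Real.exp (μ + -w/2) := by
    apply Real.exp_le_exp.mpr
    linarith
  rw [Real.exp_add] at f1 f2
  rw [abs_le]
  constructor <;> linarith

/-- The real-sequence version of the stability of quasi-lines. -/
lemma seq_lemma (lam E c : ℝ) (hlam : 0 < lam) (hE : 0 < E) (hc : 0 ≤ c) : ∃ W0 : ℝ,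
    ∀ (L W : ℤ → ℝ) (B : ℝ),
    (∀ (s : ℤ) (m : ℕ), (m:ℝ) * Real.log 4 ≤
      E * (Real.log 4 + (W s + W (s + m)) / 2 + |L s - L (s + m)| / 2 + 1)) →
    (∀ s, |L (s+1) - L s| ≤ 2 * lam * Real.exp (-(W s) / 2)) →
    (∀ s, |L (s+1) - L s| ≤ 2 * lam * Real.exp (-(W (s+1)) / 2)) →
    (∀ s, W s ≤ W (s+1) + c) → (∀ s, W s ≤ B) → W 0 ≤ W0 := by
  have hl4 : 0 < Real.log 4 := Real.log_pos (by norm_num)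
  set ε := Real.log 4 / E with hε
  have hεpos : 0 < ε := by positivity
  obtain ⟨Ws, hWs⟩ : ∃ Ws : ℝ, 2 * lam * Real.exp (-Ws/2) ≤ ε := by
    refine ⟨-2 * Real.log (ε / (2*lam)), ?_⟩
    have : -(-2 * Real.log (ε / (2*lam))) / 2 = Real.log (ε / (2 * lam)) := by ring
    rw [this, Real.exp_log (by positivity)]
    apply le_of_eq; field_simp
  set S0 := 2 * E * (Real.log 4 + Ws + 1) / Real.log 4 with hS0
  refine ⟨max Ws (Ws + c * S0), ?_⟩
  intro L W B h1 h2 h3 h4 h5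
  have high : ∀ x, Ws < x → 2 * lam * Real.exp (-x/2) ≤ ε := by
    intro x hx
    refine le_trans ?_ hWs
    have : Real.exp (-x/2) ≤ Real.exp (-Ws/2) := Real.exp_le_exp.mpr (by linarith)
    have : 0 < 2 * lam := by linarith
    gcongr
  have drift : ∀ (s : ℤ) (m : ℕ), (∀ i : ℕ, i < m → Ws < W (s + i) ∨ Ws < W (s + i + 1)) →
      |L s - L (s + m)| ≤ m * ε := by
    intro s m
    induction m with
    | zero => intro _; simp
    | succ m ih =>
      intro hi
      have i1 := ih (fun i him => hi i (by omega))
      have i2 : |L (s + m + 1) - L (s + m)| ≤ ε := by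
        rcases hi m (by omega) with hh | hh
        · exact (h2 (s+m)).trans (high _ hh)
        · exact (h3 (s+m)).trans (high _ hh)
      have e : s + ((m+1 : ℕ) : ℤ) = s + m + 1 := by push_cast; ring
      rw [e]
      push_cast
      rw [abs_le] at *
      constructor <;> linarith
  have seg : ∀ (s : ℤ) (m : ℕ), (∀ i : ℕ, i < m → Ws < W (s + i) ∨ Ws < W (s + i + 1)) →
      (m:ℝ) * Real.log 4 / 2 ≤ E * (Real.log 4 + (W s + W (s + m)) / 2 + 1) := by
    intro s m hi
    have a := h1 s m
    have b := drift s m hi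
    have : E * (|L s - L (s + m)| / 2) ≤ E * (m * ε / 2) := by gcongr
    have e : E * (m * ε / 2) = m * Real.log 4 / 2 := by rw [hε]; field_simp
    rw [e] at this
    linarith
  by_cases h0 : W 0 ≤ Ws
  · exact h0.trans (le_max_left _ _)
  push Not at h0
  have unb : ∀ C : ℝ, ∃ m : ℕ, C < (m:ℝ) * Real.log 4 / 2 := by
    intro C
    obtain ⟨m, hm⟩ := exists_nat_gt (C * 2 / Real.log 4)
    refine ⟨m, ?_⟩
    rw [div_lt_iff₀ hl4] at hm
    linarith
  have ex2 : ∃ s : ℕ, W (s : ℤ) ≤ Ws := by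
    by_contra hcon
    push Not at hcon
    obtain ⟨m, hm⟩ := unb (E * (Real.log 4 + (B + B) / 2 + 1))
    have a := seg 0 m (fun i _ => Or.inl (by simpa using hcon i))
    have : E * (Real.log 4 + (W 0 + W (0 + m)) / 2 + 1) ≤ E * (Real.log 4 + (B + B) / 2 + 1) := by
      have := h5 0
      have := h5 (0+m)
      gcongr
    linarith
  have ex1 : ∃ s : ℕ, W (-(s : ℤ)) ≤ Ws := by
    by_contra hcon
    push Not at hcon
    obtain ⟨m, hm⟩ := unb (E * (Real.log 4 + (B + B) / 2 + 1))
    have a := seg (-(m:ℤ)) m (fun i hi => Or.inl (by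
      have := hcon (m - i)
      have e : -((m - i : ℕ) : ℤ) = -(m:ℤ) + i := by push_cast [Nat.cast_sub hi.le]; ring
      rwa [e] at this))
    have : E * (Real.log 4 + (W (-(m:ℤ)) + W (-(m:ℤ) + m)) / 2 + 1) ≤
        E * (Real.log 4 + (B + B) / 2 + 1) := by
      have := h5 (-(m:ℤ))
      have := h5 (-(m:ℤ)+m)
      gcongr
    linarith
  classical
  obtain ⟨s2, hs2, hs2'⟩ : ∃ s2 : ℕ, W (s2:ℤ) ≤ Ws ∧ ∀ i : ℕ, i < s2 → Ws < W (i:ℤ) :=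
    ⟨Nat.find ex2, Nat.find_spec ex2, fun i hi => by simpa using Nat.find_min ex2 hi⟩
  obtain ⟨s1, hs1, hs1'⟩ : ∃ s1 : ℕ, W (-(s1:ℤ)) ≤ Ws ∧ ∀ i : ℕ, i < s1 → Ws < W (-(i:ℤ)) :=
    ⟨Nat.find ex1, Nat.find_spec ex1, fun i hi => by simpa using Nat.find_min ex1 hi⟩
  have hs1pos : 0 < s1 := by
    rcases Nat.eq_zero_or_pos s1 with h | h
    · rw [h] at hs1; simp at hs1; linarith
    · exact h
  have mid : ∀ t : ℤ, -(s1:ℤ) < t → t < s2 → Ws < W t := by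
    intro t ht1 ht2
    rcases le_total 0 t with h | h
    · obtain ⟨i, rfl⟩ := Int.eq_ofNat_of_zero_le h
      exact hs2' i (by omega)
    · obtain ⟨i, hi⟩ := Int.eq_ofNat_of_zero_le (by omega : 0 ≤ -t)
      have : t = -(i:ℤ) := by omega
      rw [this]
      exact hs1' i (by omega)
  have a := seg (-(s1:ℤ)) (s1 + s2) (fun i hi => by
    rcases Nat.eq_zero_or_pos i with h | h
    · right
      apply mid
      · omega
      · subst h
        rcases Nat.eq_zero_or_pos s2 with h' | h'
        · rw [h'] at hs2; simp at hs2; linarith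
        · push_cast; omega
    · left
      apply mid <;> omega)
  have e : -(s1:ℤ) + ((s1 + s2 : ℕ) : ℤ) = s2 := by push_cast; ring
  rw [e] at a
  have hm : ((s1 + s2 : ℕ) : ℝ) ≤ S0 := by
    rw [hS0, le_div_iff₀ hl4]
    have : E * (Real.log 4 + (W (-(s1:ℤ)) + W s2) / 2 + 1) ≤ E * (Real.log 4 + Ws + 1) := by
      apply mul_le_mul_of_nonneg_left _ hE.le
      linarith
    linarith
  have grow : ∀ m : ℕ, W 0 ≤ W (m:ℤ) + c * m := by
    intro m
    induction m with
    | zero => simp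
    | succ m ih =>
      have := h4 m
      push_cast
      linarith
  have g2 := grow s2
  have : c * (s2:ℝ) ≤ c * S0 := by
    apply mul_le_mul_of_nonneg_left _ hc
    push_cast at hm
    have : (0:ℝ) ≤ s1 := Nat.cast_nonneg _
    linarith
  exact le_trans (by linarith) (le_max_right _ _)

end Shalom

namespace Shalom

/-- A coarse bijective relation on `SL(2, ℂ)` at finite distance from the identity. -/
structure Good (lam : ℝ) (Q : S → S → Prop) : Prop where
  total : ∀ p, ∃ p', Q p p'
  surj : ∀ p', ∃ p, Q p p'
  lip : ∀ p1 p1' p2 p2', Q p1 p1' → Q p2 p2' → M (p1⁻¹ * p2) ≤ 9 → M (p1'⁻¹ * p2') ≤ lam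
  lip' : ∀ p1 p1' p2 p2', Q p1 p1' → Q p2 p2' → M (p1'⁻¹ * p2') ≤ 9 → M (p1⁻¹ * p2) ≤ lam
  fin : ∃ B, ∀ p p', Q p p' → M (p⁻¹ * p') ≤ B

lemma chain {lam : ℝ} (hl : 2 ≤ lam) {Q : S → S → Prop} (hQ : Good lam Q) (n : ℕ) :
    ∀ p1 p1' p2 p2', Q p1 p1' → Q p2 p2' → M (p1'⁻¹ * p2') ≤ 9 * 2 ^ n →
      M (p1⁻¹ * p2) ≤ lam ^ (n + 1) := by
  induction n with
  | zero =>
    intro p1 p1' p2 p2' h1 h2 h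
    simpa using hQ.lip' _ _ _ _ h1 h2 (by simpa using h)
  | succ n ih =>
    intro p1 p1' p2 p2' h1 h2 h
    by_cases h6 : 6 ≤ M (p1'⁻¹ * p2')
    · obtain ⟨k, hk, hk2⟩ := reduce _ h6
      obtain ⟨q, hq⟩ := hQ.surj (p2' * k)
      have a := ih p1 p1' q (p2' * k) h1 hq (by
        rw [← mul_assoc]
        refine hk2.trans ?_
        rw [pow_succ] at h
        linarith)
      have b := hQ.lip' q (p2' * k) p2 p2' hq h2 (by
        have : (p2' * k)⁻¹ * p2' = k⁻¹ := by group
        rw [this, M_inv]; exact hk)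
      have e : p1⁻¹ * p2 = (p1⁻¹ * q) * (q⁻¹ * p2) := by group
      rw [e]
      refine (M_mul_le _ _).trans ?_
      rw [pow_succ lam (n+1)]
      have := M_pos (q⁻¹ * p2)
      gcongr
    · have a := hQ.lip' _ _ _ _ h1 h2 (by linarith)
      refine a.trans ?_
      exact le_self_pow₀ (by linarith) (by omega)

lemma chain_log {lam : ℝ} (hl : 2 ≤ lam) {Q : S → S → Prop} (hQ : Good lam Q)
    (p1 p1' p2 p2' : S) (h1 : Q p1 p1') (h2 : Q p2 p2') :
    Real.log (M (p1⁻¹ * p2)) ≤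
      (2 * Real.log lam / Real.log 2) * (Real.log (M (p1'⁻¹ * p2')) + 1) := by
  have hl2 : 0 < Real.log 2 := Real.log_pos (by norm_num)
  have hl2' : Real.log 2 ≤ 1 := by
    have := Real.log_le_sub_one_of_pos (show (0:ℝ) < 2 by norm_num)
    linarith
  have hll : 0 < Real.log lam := Real.log_pos (by linarith)
  set x := Real.log (M (p1'⁻¹ * p2')) with hx
  have hx0 : 0 ≤ x := Real.log_nonneg (by linarith [two_le_M (p1'⁻¹ * p2')])
  set n := ⌈x / Real.log 2⌉₊ with hn
  have n1 : x / Real.log 2 ≤ n := Nat.le_ceil _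
  have n2 : (n:ℝ) < x / Real.log 2 + 1 := Nat.ceil_lt_add_one (by positivity)
  have hM : M (p1'⁻¹ * p2') ≤ 9 * 2 ^ n := by
    have : M (p1'⁻¹ * p2') = Real.exp x := by rw [hx, Real.exp_log (M_pos _)]
    rw [this]
    have e : (2:ℝ) ^ n = Real.exp (n * Real.log 2) := by
      rw [Real.exp_nat_mul, Real.exp_log (by norm_num)]
    have : Real.exp x ≤ 2 ^ n := by
      rw [e]
      apply Real.exp_le_exp.mpr
      rwa [div_le_iff₀ hl2] at n1
    have : (0:ℝ) < 2 ^ n := by positivity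
    linarith
  have h := chain hl hQ n p1 p1' p2 p2' h1 h2 hM
  have h' := Real.log_le_log (M_pos _) h
  rw [Real.log_pow] at h'
  refine h'.trans ?_
  push_cast
  calc ((n:ℝ) + 1) * Real.log lam ≤ (x / Real.log 2 + 1 + 1) * Real.log lam := by gcongr
    _ ≤ _ := by
      have : (2 * Real.log lam / Real.log 2) * (x + 1) - (x / Real.log 2 + 1 + 1) * Real.log lam
        = Real.log lam * ((x + 2 - 2 * Real.log 2) / Real.log 2) := by field_simp; ring
      have : 0 ≤ Real.log lam * ((x + 2 - 2 * Real.log 2) / Real.log 2) := by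
        apply mul_nonneg hll.le
        apply div_nonneg _ hl2.le
        linarith
      linarith

lemma exists_a : ∃ a : S, M a ≤ 9 ∧ (∀ x, al (a * x) = 4 * al x) ∧ (∀ x, de (a * x) = de x / 4) := by
  obtain ⟨a, a0, a1, a2, a3⟩ := mkS 2 0 0 (1/2) (by norm_num)
  refine ⟨a, ?_, ?_, ?_⟩
  · unfold M al de
    rw [a0, a1, a2, a3]
    norm_num
  · intro x
    unfold al
    rw [mul_entry, mul_entry, a0, a1]
    simp [mul_pow]; ring
  · intro x
    unfold de
    rw [mul_entry, mul_entry, a2, a3]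
    simp [mul_pow]; ring

lemma line_bound (lam : ℝ) (hl : 2 ≤ lam) : ∃ W0 : ℝ, ∀ Q, Good lam Q → ∀ h0 p', Q h0 p' →
    Wl (h0⁻¹ * p') ≤ W0 := by
  have hll : 0 < Real.log lam := Real.log_pos (by linarith)
  have hl2 : 0 < Real.log 2 := Real.log_pos (by norm_num)
  obtain ⟨W0, hW0⟩ := seq_lemma lam (2 * Real.log lam / Real.log 2) (2 * Real.log lam)
    (by linarith) (by positivity) (by positivity)
  refine ⟨W0, ?_⟩
  intro Q hQ h0 p' hp
  obtain ⟨a, ha9, haal, hade⟩ := exists_a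
  obtain ⟨f, hf, hf0⟩ : ∃ f : ℤ → S, (∀ s, Q (h0 * a ^ s) (f s)) ∧ f 0 = p' := by
    choose f hf using fun s : ℤ => hQ.total (h0 * a ^ s)
    refine ⟨fun s => if s = 0 then p' else f s, ?_, by simp⟩
    intro s
    by_cases h : s = 0
    · subst h; simpa using hp
    · simpa [h] using hf s
  have hWa : ∀ x, Wl (a * x) = Wl x := by
    intro x
    unfold Wl
    rw [haal, hade, Real.log_mul (by norm_num) (al_pos x).ne',
      Real.log_div (de_pos x).ne' (by norm_num)]
    ring
  have hWas : ∀ (s : ℤ) x, Wl (a ^ s * x) = Wl x := by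
    intro s x
    induction s using Int.induction_on with
    | zero => simp
    | succ i ih => rw [add_comm, _root_.zpow_one_add, mul_assoc, hWa, ih]
    | pred i ih =>
      rw [← ih, ← hWa (a ^ (-(i:ℤ) - 1) * x), ← mul_assoc, ← _root_.zpow_one_add]
      congr 3
      ring
  have hala : ∀ m : ℕ, al (a ^ m) = 4 ^ m * al 1 := by
    intro m
    induction m with
    | zero => simp
    | succ m ih => rw [pow_succ', haal, ih, pow_succ]; ring
  have hal1 : al (1 : S) = 1 := by unfold al; simp
  have hMa : ∀ m : ℕ, (m:ℝ) * Real.log 4 ≤ Real.log (M (a ^ m)) := by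
    intro m
    rw [← Real.log_pow]
    apply Real.log_le_log (by positivity)
    have := hala m
    have := de_nonneg (a ^ m)
    unfold M
    rw [hala, hal1]; linarith
  obtain ⟨B, hB⟩ := hQ.fin
  have hstep : ∀ s : ℤ, M ((f s)⁻¹ * f (s+1)) ≤ lam := by
    intro s
    refine hQ.lip _ _ _ _ (hf s) (hf (s+1)) ?_
    have : (h0 * a ^ s)⁻¹ * (h0 * a ^ (s+1)) = a := by group
    rw [this]; exact ha9
  have e1 : ∀ s, h0⁻¹ * f (s+1) = (h0⁻¹ * f s) * ((f s)⁻¹ * f (s+1)) := by intro s; group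
  have e2 : ∀ s, h0⁻¹ * f s = (h0⁻¹ * f (s+1)) * ((f s)⁻¹ * f (s+1))⁻¹ := by intro s; group
  have hB0 : 0 < B := (M_pos _).trans_le (hB _ _ hp)
  have := hW0 (fun s => Lr (h0⁻¹ * f s)) (fun s => Wl (h0⁻¹ * f s)) (2 * Real.log B) ?_ ?_ ?_ ?_ ?_
  · simpa [hf0] using this
  · intro s m
    refine (hMa m).trans ?_
    have c := chain_log hl hQ _ _ _ _ (hf s) (hf (s+m))
    have : (h0 * a ^ s)⁻¹ * (h0 * a ^ (s+(m:ℤ))) = a ^ m := by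
      rw [_root_.zpow_add, zpow_natCast]; group
    rw [this] at c
    refine c.trans ?_
    have d := logM_dist (h0⁻¹ * f s) (h0⁻¹ * f (s+m))
    have e : (h0⁻¹ * f s)⁻¹ * (h0⁻¹ * f (s+m)) = (f s)⁻¹ * f (s+m) := by group
    rw [e] at d
    apply mul_le_mul_of_nonneg_left _ (by positivity)
    linarith
  · intro s
    have c := contr (h0⁻¹ * f s) ((f s)⁻¹ * f (s+1))
    rw [← e1] at c
    refine c.trans ?_
    have := hstep s
    gcongr
  · intro s
    have c := contr (h0⁻¹ * f (s+1)) ((f s)⁻¹ * f (s+1))⁻¹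
    rw [← e2, abs_sub_comm, M_inv] at c
    refine c.trans ?_
    have := hstep s
    gcongr
  · intro s
    have c := Wl_mul_le (h0⁻¹ * f (s+1)) ((f s)⁻¹ * f (s+1))⁻¹
    rw [← e2, M_inv] at c
    refine c.trans ?_
    have := Real.log_le_log (M_pos _) (hstep s)
    linarith
  · intro s
    have e : h0⁻¹ * f s = a ^ s * (1 * ((h0 * a ^ s)⁻¹ * f s)) := by group
    show Wl (h0⁻¹ * f s) ≤ _
    rw [e, hWas]
    refine (Wl_mul_le _ _).trans ?_
    have := Real.log_le_log (M_pos _) (hB _ _ (hf s))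
    have w1 : Wl (1:S) = 0 := by
      have : de (1:S) = 1 := by unfold de; simp
      unfold Wl; rw [this, hal1]; simp
    linarith

lemma cross (p q r s : ℂ) : ∃ y : ℝ,
    ‖p / 2 - r‖^2 + ‖q / 2 - s‖^2 = (‖p‖^2 + ‖q‖^2) / 4 + (‖r‖^2 + ‖s‖^2) - y ∧
    ‖p / 2 + r‖^2 + ‖q / 2 + s‖^2 = (‖p‖^2 + ‖q‖^2) / 4 + (‖r‖^2 + ‖s‖^2) + y ∧
    y^2 ≤ (‖p‖^2 + ‖q‖^2) * (‖r‖^2 + ‖s‖^2) := by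
  refine ⟨p.re * r.re + p.im * r.im + q.re * s.re + q.im * s.im, ?_, ?_, ?_⟩
  · simp only [Complex.sq_norm, Complex.normSq_apply, Complex.sub_re, Complex.sub_im,
      Complex.div_ofNat_re, Complex.div_ofNat_im]
    ring
  · simp only [Complex.sq_norm, Complex.normSq_apply, Complex.add_re, Complex.add_im,
      Complex.div_ofNat_re, Complex.div_ofNat_im]
    ring
  · simp only [Complex.sq_norm, Complex.normSq_apply]
    nlinarith [sq_nonneg (p.re * r.im - p.im * r.re), sq_nonneg (p.re * s.re - q.re * r.re),
      sq_nonneg (p.re * s.im - q.im * r.re), sq_nonneg (p.im * s.re - q.re * r.im),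
      sq_nonneg (p.im * s.im - q.im * r.im), sq_nonneg (q.re * s.im - q.im * s.re)]

lemma rigid (lam : ℝ) (hl : 2 ≤ lam) : ∃ C : ℝ, ∀ Q, Good lam Q → ∀ p p', Q p p' →
    M (p⁻¹ * p') ≤ C := by
  obtain ⟨W0, hW0⟩ := line_bound lam hl
  set W1 := W0 + 2 * Real.log lam with hW1
  refine ⟨4 * (1 + Real.exp W0 + Real.exp W1), ?_⟩
  intro Q hQ h0 p' hp
  obtain ⟨κ, k0, k1, k2, k3⟩ := mkS (1/2) (-1) (1/2) 1 (by norm_num)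
  have hκ : M κ ≤ 9 := by
    unfold M al de
    rw [k0, k1, k2, k3]; norm_num
  obtain ⟨p'', hp''⟩ := hQ.total (h0 * κ⁻¹)
  have a := hW0 Q hQ _ _ hp
  have b := hW0 Q hQ _ _ hp''
  have c := hQ.lip _ _ _ _ hp'' hp (by
    have : (h0 * κ⁻¹)⁻¹ * h0 = κ := by group
    rw [this]; exact hκ)
  have d := Wl_mul_le ((h0 * κ⁻¹)⁻¹ * p'') (p''⁻¹ * p')
  have e : (h0 * κ⁻¹)⁻¹ * p'' * (p''⁻¹ * p') = κ * (h0⁻¹ * p') := by group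
  rw [e] at d
  have d2 : Wl (κ * (h0⁻¹ * p')) ≤ W1 := by
    have := Real.log_le_log (M_pos _) c
    linarith
  set g := h0⁻¹ * p'
  have conv : ∀ (x : S) (W : ℝ), Wl x ≤ W → al x * de x ≤ Real.exp W := by
    intro x W h
    unfold Wl at h
    rw [← Real.log_mul (al_pos x).ne' (de_pos x).ne'] at h
    exact (Real.log_le_iff_le_exp (mul_pos (al_pos x) (de_pos x))).mp h
  have A := conv _ _ a
  have D := conv _ _ d2
  obtain ⟨y, y1, y2, y3⟩ := cross (g.1 0 0) (g.1 0 1) (g.1 1 0) (g.1 1 1)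
  have r1 : al (κ * g) = al g / 4 + de g - y := by
    unfold al de
    rw [← y1, mul_entry κ g, mul_entry κ g, k0, k1]
    congr 3 <;> ring
  have r2 : de (κ * g) = al g / 4 + de g + y := by
    unfold al de
    rw [← y2, mul_entry κ g, mul_entry κ g, k2, k3]
    congr 3 <;> ring
  rw [r1, r2] at D
  have y4 : y^2 ≤ al g * de g := y3
  have hag := al_nonneg g
  have hdg := de_nonneg g
  have q : M g ≤ 4 * (al g / 4 + de g) := by unfold M; linarith
  set x := al g / 4 + de g
  nlinarith [sq_nonneg (x - 1), Real.exp_pos W0, Real.exp_pos W1]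

end Shalom

namespace Shalom

/-- cocompactness along `φ` -/
def EE {G : Type*} [Group G] (N : G → ℝ) (Γ : Subgroup G) (φ : S →* G) : Prop :=
  ∃ R, ∀ g, ∃ γ ∈ Γ, ∃ h, N (γ * g * φ h) ≤ R

/-- properness along `φ` -/
def PP {G : Type*} [Group G] (N : G → ℝ) (Γ : Subgroup G) (φ : S →* G) : Prop :=
  ∀ R, ∃ B, ∀ γ ∈ Γ, ∀ g h, N g ≤ R → N (γ * g * φ h) ≤ R → M h ≤ B

/-- norm control of `φ` -/
def NC {G : Type*} [Group G] (N : G → ℝ) (φ : S →* G) : Prop :=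
  ∀ A, ∃ B, 1 ≤ B ∧ ∀ h, M h ≤ A → N (φ h) ≤ B

section
variable {G : Type*} [Group G] {N : G → ℝ} {Γ : Subgroup G}

lemma step (h1 : ∀ g, 1 ≤ N g) (hmul : ∀ a b, N (a * b) ≤ N a * N b)
    {φ ψ : S →* G} (hP : PP N Γ ψ) (hφ : NC N φ) (R A : ℝ) : ∃ B, ∀ γ ∈ Γ, ∀ v l p,
    N v ≤ R → N (γ * v * ψ l * φ p) ≤ R → M p ≤ A → M l ≤ B := by
  obtain ⟨C, hC1, hC⟩ := hφ A
  obtain ⟨B, hB⟩ := hP (R * C)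
  refine ⟨B, ?_⟩
  intro γ hγ v l p hv hv' hp
  have hR : 1 ≤ R := (h1 v).trans hv
  refine hB γ hγ v l ?_ ?_
  · nlinarith
  · have e : γ * v * ψ l = (γ * v * ψ l * φ p) * φ p⁻¹ := by rw [map_inv]; group
    rw [e]
    refine (hmul _ _).trans ?_
    have := hC p⁻¹ (by rwa [M_inv])
    have := h1 (φ p⁻¹)
    gcongr

/-- The relation comparing the two orbits. -/
def QQ (N : G → ℝ) (Γ : Subgroup G) (φ ψ : S →* G) (R : ℝ) (g t : G) (p p' : S) : Prop :=
  ∃ l : S, (∃ γ ∈ Γ, N (γ * g * ψ l * φ p) ≤ R) ∧ (∃ γ ∈ Γ, N (γ * (g * t) * ψ l * φ p') ≤ R)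

lemma lip_aux (h1 : ∀ g, 1 ≤ N g) (hmul : ∀ a b, N (a * b) ≤ N a * N b)
    {φ ψ : S →* G} (hc : ∀ a b, φ a * ψ b = ψ b * φ a)
    (hPφ : PP N Γ φ) (hPψ : PP N Γ ψ) (hφ : NC N φ) (hψ : NC N ψ) (R : ℝ) :
    ∃ lam, 2 ≤ lam ∧ ∀ g g' l1 l2 p1 p2 p1' p2', ∀ γ1 ∈ Γ, ∀ γ2 ∈ Γ, ∀ γ1' ∈ Γ, ∀ γ2' ∈ Γ,
      N (γ1 * g * ψ l1 * φ p1) ≤ R → N (γ2 * g * ψ l2 * φ p2) ≤ R →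
      N (γ1' * g' * ψ l1 * φ p1') ≤ R → N (γ2' * g' * ψ l2 * φ p2') ≤ R →
      M (p1⁻¹ * p2) ≤ 9 → M (p1'⁻¹ * p2') ≤ lam := by
  obtain ⟨B1, hB1⟩ := step h1 hmul hPψ hφ R 9
  obtain ⟨B2, hB2⟩ := step h1 hmul hPφ hψ R B1
  refine ⟨max 2 B2, le_max_left _ _, ?_⟩
  intro g g' l1 l2 p1 p2 p1' p2' γ1 m1 γ2 m2 γ1' m1' γ2' m2' n1 n2 n1' n2' h9
  have key : ∀ (a b g : G) (l1 l2 p1 p2 : S), b * g * ψ l2 * φ p2 =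
      (b * a⁻¹) * (a * g * ψ l1 * φ p1) * ψ (l1⁻¹ * l2) * φ (p1⁻¹ * p2) := by
    intro a b g l1 l2 p1 p2
    have : (b * a⁻¹) * (a * g * ψ l1 * φ p1) * ψ (l1⁻¹ * l2) * φ (p1⁻¹ * p2) =
       b * g * ψ l1 * (φ p1 * ψ (l1⁻¹ * l2)) * φ (p1⁻¹ * p2) := by group
    rw [this, hc, map_mul, map_mul, map_inv, map_inv]
    group
  rw [key γ1 γ2 g l1 l2 p1 p2] at n2
  have a1 := hB1 (γ2 * γ1⁻¹) (Γ.mul_mem m2 (Γ.inv_mem m1)) _ _ _ n1 n2 h9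
  rw [key γ1' γ2' g' l1 l2 p1' p2', mul_assoc _ (ψ _), ← hc, ← mul_assoc] at n2'
  have a2 := hB2 (γ2' * γ1'⁻¹) (Γ.mul_mem m2' (Γ.inv_mem m1')) _ _ _ n1' n2' a1
  exact a2.trans (le_max_right _ _)

lemma good_QQ (h1 : ∀ g, 1 ≤ N g) (hmul : ∀ a b, N (a * b) ≤ N a * N b)
    {φ ψ : S →* G} (hc : ∀ a b, φ a * ψ b = ψ b * φ a)
    (hPφ : PP N Γ φ) (hPψ : PP N Γ ψ) (hφ : NC N φ) (hψ : NC N ψ) (R : ℝ)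
    (hEφ : ∀ g, ∃ γ ∈ Γ, ∃ h, N (γ * g * φ h) ≤ R)
    (hEψ : ∀ g, ∃ γ ∈ Γ, ∃ h, N (γ * g * ψ h) ≤ R) :
    ∃ lam, 2 ≤ lam ∧ ∀ g t, (∀ a, t * φ a = φ a * t) → (∀ a, t * ψ a = ψ a * t) →
      Good lam (QQ N Γ φ ψ R g t) := by
  obtain ⟨lam, hl, H⟩ := lip_aux h1 hmul hc hPφ hPψ hφ hψ R
  refine ⟨lam, hl, ?_⟩
  intro g t htφ htψ
  constructor
  · intro p
    obtain ⟨γ, hγ, l, hl⟩ := hEψ (g * φ p)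
    obtain ⟨γ', hγ', p', hp'⟩ := hEφ (g * t * ψ l)
    refine ⟨p', l, ⟨γ, hγ, ?_⟩, ⟨γ', hγ', ?_⟩⟩
    · rw [← mul_assoc, mul_assoc _ (φ p), hc, ← mul_assoc] at hl
      exact hl
    · simpa only [mul_assoc] using hp'
  · intro p'
    obtain ⟨γ', hγ', l, hl⟩ := hEψ (g * t * φ p')
    obtain ⟨γ, hγ, p, hp⟩ := hEφ (g * ψ l)
    refine ⟨p, l, ⟨γ, hγ, ?_⟩, ⟨γ', hγ', ?_⟩⟩
    · simpa only [mul_assoc] using hp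
    · rw [← mul_assoc, mul_assoc _ (φ p'), hc, ← mul_assoc] at hl
      exact hl
  · rintro p1 p1' p2 p2' ⟨l1, ⟨γ1, m1, n1⟩, ⟨γ1', m1', n1'⟩⟩ ⟨l2, ⟨γ2, m2, n2⟩, ⟨γ2', m2', n2'⟩⟩ h9
    exact H _ _ _ _ _ _ _ _ γ1 m1 γ2 m2 γ1' m1' γ2' m2' n1 n2 n1' n2' h9
  · rintro p1 p1' p2 p2' ⟨l1, ⟨γ1, m1, n1⟩, ⟨γ1', m1', n1'⟩⟩ ⟨l2, ⟨γ2, m2, n2⟩, ⟨γ2', m2', n2'⟩⟩ h9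
    exact H _ _ _ _ _ _ _ _ γ1' m1' γ2' m2' γ1 m1 γ2 m2 n1' n2' n1 n2 h9
  · obtain ⟨B, hB⟩ := hPφ (R * N t)
    refine ⟨B, ?_⟩
    rintro p p' ⟨l, ⟨γ, m, n⟩, ⟨γ', m', n'⟩⟩
    have hR : 1 ≤ R := (h1 _).trans n
    have ht := h1 t
    refine hB (γ' * γ⁻¹) (Γ.mul_mem m' (Γ.inv_mem m)) (γ * g * ψ l * φ p * t) (p⁻¹ * p') ?_ ?_
    · refine (hmul _ _).trans ?_
      gcongr
    · have e : γ' * γ⁻¹ * (γ * g * ψ l * φ p * t) * φ (p⁻¹ * p') =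
          γ' * (g * t) * ψ l * φ p' := by
        have : γ' * γ⁻¹ * (γ * g * ψ l * φ p * t) * φ (p⁻¹ * p') =
          γ' * g * ψ l * (φ p * (t * φ (p⁻¹ * p'))) := by group
        rw [this, htφ, map_mul, map_inv]
        have : γ' * g * ψ l * (φ p * ((φ p)⁻¹ * φ p' * t)) = γ' * g * ψ l * (φ p' * t) := by group
        rw [this, ← htφ]
        have : γ' * g * ψ l * (t * φ p') = γ' * g * (ψ l * t) * φ p' := by group
        rw [this, ← htψ]
        group
      rw [e]
      nlinarith

theorem core (h1 : ∀ g, 1 ≤ N g) (hmul : ∀ a b, N (a * b) ≤ N a * N b)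
    {φ ψ : S →* G} (hc : ∀ a b, φ a * ψ b = ψ b * φ a)
    (hPφ : PP N Γ φ) (hPψ : PP N Γ ψ) (hφ : NC N φ) (hψ : NC N ψ)
    (hEφ : EE N Γ φ) (hEψ : EE N Γ ψ)
    (T : Set G) (htφ : ∀ t ∈ T, ∀ a, t * φ a = φ a * t) (htψ : ∀ t ∈ T, ∀ a, t * ψ a = ψ a * t)
    (u : ℝ → G) (hU : ∀ R, ∃ B, ∀ γ ∈ Γ, ∀ g z, N g ≤ R → N (γ * g * u z) ≤ R → z ≤ B)
    (c : ℝ) (hut : ∀ z, ∃ t ∈ T, N (t * u z * t⁻¹) ≤ c) : False := by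
  obtain ⟨R1, hR1⟩ := hEφ
  obtain ⟨R2, hR2⟩ := hEψ
  set R := max R1 R2 with hR
  have eφ : ∀ g, ∃ γ ∈ Γ, ∃ h, N (γ * g * φ h) ≤ R := fun g => by
    obtain ⟨γ, m, h, n⟩ := hR1 g
    exact ⟨γ, m, h, n.trans (le_max_left _ _)⟩
  have eψ : ∀ g, ∃ γ ∈ Γ, ∃ h, N (γ * g * ψ h) ≤ R := fun g => by
    obtain ⟨γ, m, h, n⟩ := hR2 g
    exact ⟨γ, m, h, n.trans (le_max_right _ _)⟩
  obtain ⟨lam, hl, hgood⟩ := good_QQ h1 hmul hc hPφ hPψ hφ hψ R eφ eψ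
  obtain ⟨W0, hW0⟩ := rigid lam hl
  have claim : ∀ c, ∃ R3, ∀ g, N g ≤ c → ∀ t ∈ T, ∃ γ ∈ Γ, N (γ * g * t) ≤ R3 := by
    intro c
    obtain ⟨B, hB⟩ := hPφ (max R c)
    obtain ⟨C1, hC11, hC1⟩ := hφ B
    obtain ⟨C2, hC21, hC2⟩ := hφ W0
    refine ⟨R * C2 * C1, ?_⟩
    intro g hg t ht
    obtain ⟨γ0, m0, h, n0⟩ := eφ g
    obtain ⟨γ', m', p', n'⟩ := eφ (g * t)
    have q : QQ N Γ φ ψ R g t h p' := ⟨1, ⟨γ0, m0, by simpa using n0⟩, ⟨γ', m', by simpa using n'⟩⟩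
    have w := hW0 _ (hgood g t (htφ t ht) (htψ t ht)) h p' q
    have b := hB γ0 m0 g h (hg.trans (le_max_right _ _)) (n0.trans (le_max_left _ _))
    refine ⟨γ', m', ?_⟩
    have e : γ' * g * t = (γ' * (g * t) * φ p') * φ ((h⁻¹ * p')⁻¹) * φ h⁻¹ := by
      rw [map_inv, map_inv, map_mul, map_inv]; group
    rw [e]
    refine (hmul _ _).trans ?_
    have a1 := hC1 h⁻¹ (by rwa [M_inv])
    have a2 := hC2 (h⁻¹ * p')⁻¹ (by rwa [M_inv])
    have a3 := hmul (γ' * (g * t) * φ p') (φ ((h⁻¹ * p')⁻¹))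
    have p1 := h1 (φ h⁻¹)
    have p2 := h1 (φ ((h⁻¹ * p')⁻¹))
    have p3 : 1 ≤ R := (h1 _).trans n'
    have a4 : N (γ' * (g * t) * φ p' * φ ((h⁻¹ * p')⁻¹)) ≤ R * C2 := by
      refine a3.trans ?_
      gcongr
    gcongr
  obtain ⟨R3, hR3⟩ := claim (max c (N 1))
  obtain ⟨B, hB⟩ := hU R3
  obtain ⟨t, ht, hct⟩ := hut (B + 1)
  obtain ⟨γ1, m1, n1⟩ := hR3 1 (le_max_right _ _) t ht
  obtain ⟨γ2, m2, n2⟩ := hR3 _ (hct.trans (le_max_left _ _)) t ht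
  have := hB (γ2 * γ1⁻¹) (Γ.mul_mem m2 (Γ.inv_mem m1)) _ (B + 1) n1 (by
    have e : γ2 * γ1⁻¹ * (γ1 * 1 * t) * u (B + 1) = γ2 * (t * u (B + 1) * t⁻¹) * t := by group
    rw [e]; exact n2)
  linarith

end
end Shalom

namespace Shalom

section
variable {G : Type*} [Group G] {N : G → ℝ} {Γ : Subgroup G}

lemma topo_P [TopologicalSpace G] (h1 : ∀ g, 1 ≤ N g) (hmul : ∀ a b, N (a * b) ≤ N a * N b)
    (hinv : ∀ a, N a⁻¹ = N a) (hcomp : ∀ R, IsCompact {g : G | N g ≤ R})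
    (H : Subgroup G) (φ : S →* G) (hφ : ∀ h, φ h ∈ H)
    (hM : ∀ C, ∃ B, ∀ h, N (φ h) ≤ C → M h ≤ B)
    (hpd : ∀ K L : Set (G ⧸ H), IsCompact K → IsCompact L →
          {γ : Γ | ∃ x ∈ K, ((γ : G) • x) ∈ L}.Finite) : PP N Γ φ := by
  intro R
  have hK : IsCompact ((QuotientGroup.mk : G → G ⧸ H) '' {g : G | N g ≤ R}) :=
    (hcomp R).image continuous_quotient_mk'
  have hfin := hpd _ _ hK hK
  obtain ⟨C, hC⟩ := (hfin.image (fun γ : Γ => N (γ : G))).bddAbove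
  obtain ⟨B, hB⟩ := hM (R * C * R)
  refine ⟨B, ?_⟩
  intro γ hγ g h hg hg'
  apply hB
  have hmem : N γ ≤ C := by
    apply hC
    refine ⟨⟨γ, hγ⟩, ⟨QuotientGroup.mk g, ⟨g, hg, rfl⟩, ⟨γ * g * φ h, hg', ?_⟩⟩, rfl⟩
    show (QuotientGroup.mk (γ * g * φ h) : G ⧸ H) = QuotientGroup.mk (γ * g)
    rw [QuotientGroup.eq]
    have : (γ * g * φ h)⁻¹ * (γ * g) = (φ h)⁻¹ := by group
    rw [this]
    exact H.inv_mem (hφ h)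
  have e : φ h = g⁻¹ * γ⁻¹ * (γ * g * φ h) := by group
  rw [e]
  refine (hmul _ _).trans ?_
  have a1 := hmul g⁻¹ γ⁻¹
  rw [hinv, hinv] at a1
  have := h1 g
  have := h1 γ
  have := h1 (γ * g * φ h)
  have a2 : N (g⁻¹ * γ⁻¹) ≤ R * C := by
    refine a1.trans ?_
    gcongr
    linarith
  have := h1 (g⁻¹ * γ⁻¹)
  gcongr
  linarith

lemma topo_E [TopologicalSpace G] [ContinuousMul G] (hcont : Continuous N)
    (H : Subgroup G) (φ : S →* G) (hφ : ∀ x ∈ H, ∃ h, φ h = x)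
    (hK : ∃ K : Set (G ⧸ H), IsCompact K ∧ ∀ x : G ⧸ H, ∃ γ ∈ Γ, ∃ y ∈ K, γ • y = x) :
    EE N Γ φ := by
  obtain ⟨K, hKc, hK⟩ := hK
  obtain ⟨k, hk⟩ := hKc.elim_directed_cover
    (fun k : ℕ => (QuotientGroup.mk : G → G ⧸ H) '' {g : G | N g < k})
    (fun k => QuotientGroup.isOpenMap_coe _ (isOpen_lt hcont continuous_const))
    (by
      intro x _
      induction x using QuotientGroup.induction_on with
      | H g =>
        obtain ⟨k, hk⟩ := exists_nat_gt (N g)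
        exact Set.mem_iUnion.mpr ⟨k, g, hk, rfl⟩)
    (by
      apply Monotone.directed_le
      intro a b hab
      apply Set.image_mono
      intro g hg
      have hg2 : N g < (a : ℝ) := hg
      have hab2 : (a : ℝ) ≤ b := by exact_mod_cast hab
      exact lt_of_lt_of_le hg2 hab2)
  refine ⟨k, ?_⟩
  intro g
  obtain ⟨γ, hγ, y, hy, hyg⟩ := hK (QuotientGroup.mk g)
  obtain ⟨g', hg', rfl⟩ := hk hy
  have e : (QuotientGroup.mk g : G ⧸ H) = QuotientGroup.mk (γ * g') := hyg.symm
  rw [QuotientGroup.eq] at e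
  obtain ⟨h, hh⟩ := hφ _ e
  refine ⟨γ⁻¹, Γ.inv_mem hγ, h, ?_⟩
  rw [hh]
  have : γ⁻¹ * g * (g⁻¹ * (γ * g')) = g' := by group
  rw [this]
  exact le_of_lt hg'

lemma conj_P (h1 : ∀ g, 1 ≤ N g) (hmul : ∀ a b, N (a * b) ≤ N a * N b)
    {φ : S →* G} (hP : PP N Γ φ) (x : G) (R : ℝ) :
    ∃ B, ∀ γ ∈ Γ, ∀ g h, N g ≤ R → N (γ * g * (x * φ h * x⁻¹)) ≤ R → M h ≤ B := by
  obtain ⟨B, hB⟩ := hP (R * N x)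
  refine ⟨B, ?_⟩
  intro γ hγ g h hg hg'
  have hx := h1 x
  refine hB γ hγ (g * x) h ?_ ?_
  · refine (hmul _ _).trans ?_
    gcongr
  · have e : γ * (g * x) * φ h = (γ * g * (x * φ h * x⁻¹)) * x := by group
    rw [e]
    refine (hmul _ _).trans ?_
    gcongr

lemma conj_E (h1 : ∀ g, 1 ≤ N g) (hmul : ∀ a b, N (a * b) ≤ N a * N b)
    {φ ψ : S →* G} (hE : EE N Γ φ) (x : G) (hx : ∀ h, ψ h = x * φ h * x⁻¹) : EE N Γ ψ := by
  obtain ⟨R, hR⟩ := hE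
  refine ⟨R * N x⁻¹, ?_⟩
  intro g
  obtain ⟨γ, hγ, h, hh⟩ := hR (g * x)
  refine ⟨γ, hγ, h, ?_⟩
  have e : γ * g * ψ h = (γ * (g * x) * φ h) * x⁻¹ := by rw [hx]; group
  rw [e]
  refine (hmul _ _).trans ?_
  have := h1 x⁻¹
  gcongr

lemma conj_NC (h1 : ∀ g, 1 ≤ N g) (hmul : ∀ a b, N (a * b) ≤ N a * N b)
    {φ : S →* G} (hE : NC N φ) (x : G) (A : ℝ) :
    ∃ B, 1 ≤ B ∧ ∀ h, M h ≤ A → N (x * φ h * x⁻¹) ≤ B := by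
  obtain ⟨B, hB1, hB⟩ := hE A
  have hx := h1 x
  have hx' := h1 x⁻¹
  refine ⟨N x * B * N x⁻¹, ?_, ?_⟩
  · have : 1 ≤ N x * B := one_le_mul_of_one_le_of_one_le hx hB1
    exact one_le_mul_of_one_le_of_one_le this hx'
  · intro h hh
    refine (hmul _ _).trans ?_
    have := (hmul x (φ h)).trans (mul_le_mul_of_nonneg_left (hB h hh) (by linarith))
    gcongr

end

section
variable {J : Type*} [Fintype J] [DecidableEq J]

/-- entrywise `ℓ¹` norm -/
noncomputable def nrm (A : Matrix J J ℂ) : ℝ := ∑ i, ∑ j, ‖A i j‖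

lemma nrm_nonneg (A : Matrix J J ℂ) : 0 ≤ nrm A := by unfold nrm; positivity

lemma nrm_mul (A B : Matrix J J ℂ) : nrm (A * B) ≤ nrm A * nrm B := by
  unfold nrm
  calc ∑ i, ∑ j, ‖(A * B) i j‖ ≤ ∑ i, ∑ j, ∑ k, ‖A i k‖ * ‖B k j‖ := by
        gcongr with i _ j _
        rw [Matrix.mul_apply]
        refine (norm_sum_le _ _).trans (le_of_eq ?_)
        simp
    _ = ∑ i, ∑ k, ‖A i k‖ * ∑ j, ‖B k j‖ := by
        refine Finset.sum_congr rfl (fun i _ => ?_)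
        rw [Finset.sum_comm]
        simp [Finset.mul_sum]
    _ ≤ ∑ i, ∑ k, ‖A i k‖ * (∑ k, ∑ j, ‖B k j‖) := by
        refine Finset.sum_le_sum (fun i _ => Finset.sum_le_sum (fun k _ => ?_))
        refine mul_le_mul_of_nonneg_left ?_ (norm_nonneg _)
        exact Finset.single_le_sum (f := fun k => ∑ j, ‖B k j‖) (fun _ _ => by positivity)
          (Finset.mem_univ k)
    _ = _ := by simp only [Finset.sum_mul]

lemma entry_le (A : Matrix J J ℂ) (i j : J) : ‖A i j‖ ≤ nrm A := by
  unfold nrm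
  refine le_trans ?_ (Finset.single_le_sum (f := fun i => ∑ j, ‖A i j‖)
    (fun _ _ => by positivity) (Finset.mem_univ i))
  exact Finset.single_le_sum (f := fun j => ‖A i j‖) (fun _ _ => by positivity) (Finset.mem_univ j)

/-- symmetric norm -/
noncomputable def NN (g : SpecialLinearGroup J ℂ) : ℝ := nrm g.1 + nrm (g⁻¹).1

lemma NN_inv (g : SpecialLinearGroup J ℂ) : NN g⁻¹ = NN g := by
  unfold NN; rw [inv_inv, add_comm]

lemma NN_mul (a b : SpecialLinearGroup J ℂ) : NN (a * b) ≤ NN a * NN b := by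
  unfold NN
  rw [_root_.mul_inv_rev]
  have h1 := nrm_mul a.1 b.1
  have h2 := nrm_mul (b⁻¹).1 (a⁻¹).1
  have e1 : (a * b).1 = a.1 * b.1 := rfl
  have e2 : (b⁻¹ * a⁻¹).1 = (b⁻¹).1 * (a⁻¹).1 := rfl
  rw [e1, e2]
  nlinarith [mul_nonneg (nrm_nonneg a.1) (nrm_nonneg (b⁻¹).1),
    mul_nonneg (nrm_nonneg (a⁻¹).1) (nrm_nonneg b.1)]

lemma NN_one_le [Nonempty J] (g : SpecialLinearGroup J ℂ) : 1 ≤ NN g := by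
  have h1 : 1 ≤ nrm (1 : Matrix J J ℂ) := by
    have := entry_le (1 : Matrix J J ℂ) (Classical.arbitrary J) (Classical.arbitrary J)
    simpa using this
  have h2 : nrm (1 : Matrix J J ℂ) ≤ nrm g.1 * nrm (g⁻¹).1 := by
    have := nrm_mul g.1 (g⁻¹).1
    have e : g.1 * (g⁻¹).1 = 1 := by
      have : (g * g⁻¹).1 = (1 : Matrix J J ℂ) := by rw [mul_inv_cancel]; rfl
      exact this
    rwa [e] at this
  unfold NN
  have := nrm_nonneg g.1
  have := nrm_nonneg (g⁻¹).1
  nlinarith [sq_nonneg (nrm g.1 - nrm (g⁻¹).1)]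

/-- Any invertible matrix is, up to a scalar, in `SL`. -/
lemma exists_scaled [Nonempty J] (P : Matrix J J ℂ) (hP : P.det ≠ 0) :
    ∃ x : SpecialLinearGroup J ℂ, ∀ A B : SpecialLinearGroup J ℂ, P * A.1 = B.1 * P →
      B = x * A * x⁻¹ := by
  obtain ⟨ζ, hζ⟩ := IsAlgClosed.exists_pow_nat_eq (P.det⁻¹) (Fintype.card_pos (α := J))
  obtain ⟨x, hx⟩ : ∃ x : SpecialLinearGroup J ℂ, x.1 = ζ • P :=
    ⟨⟨ζ • P, by rw [Matrix.det_smul, hζ, inv_mul_cancel₀ hP]⟩, rfl⟩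
  refine ⟨x, ?_⟩
  intro A B h
  rw [eq_mul_inv_iff_mul_eq]
  apply Subtype.ext
  show B.1 * x.1 = x.1 * A.1
  rw [hx, Matrix.mul_smul, Matrix.smul_mul, h]

lemma exists_perm [Nonempty J] (σ : Equiv.Perm J) :
    ∃ x : SpecialLinearGroup J ℂ, ∀ A B : SpecialLinearGroup J ℂ,
      (∀ i j, B.1 i (σ.symm j) = A.1 (σ i) j) → B = x * A * x⁻¹ := by
  obtain ⟨x, hx⟩ := exists_scaled ((1 : Matrix J J ℂ).submatrix σ id) (by
    rw [Matrix.det_permute]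
    rcases Int.units_eq_one_or (Equiv.Perm.sign σ) with h | h <;> rw [h] <;> simp)
  refine ⟨x, ?_⟩
  intro A B h
  apply hx
  ext i j
  have e1 : ((1 : Matrix J J ℂ).submatrix σ id * A.1) i j = A.1 (σ i) j := by
    simp [Matrix.mul_apply, Matrix.one_apply]
  have e2 : (B.1 * (1 : Matrix J J ℂ).submatrix σ id) i j = B.1 i (σ.symm j) := by
    simp [Matrix.mul_apply, Matrix.one_apply, ← Equiv.eq_symm_apply]
  rw [e1, e2, h]

end

end Shalom

namespace Shalom

/-- upper-left block embedding -/
noncomputable def blk {K : Type*} [Fintype K] [DecidableEq K] :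
    S →* SpecialLinearGroup (Fin 2 ⊕ K) ℂ where
  toFun A := ⟨fromBlocks A.1 0 0 1, by rw [Matrix.det_fromBlocks_zero₂₁, A.2]; simp⟩
  map_one' := by
    apply Subtype.ext
    show fromBlocks (1 : Matrix (Fin 2) (Fin 2) ℂ) 0 0 (1 : Matrix K K ℂ) = 1
    exact Matrix.fromBlocks_one
  map_mul' A B := by
    apply Subtype.ext
    show fromBlocks (A.1 * B.1) 0 0 (1 : Matrix K K ℂ) =
      fromBlocks A.1 0 0 1 * fromBlocks B.1 0 0 1
    simp [Matrix.fromBlocks_multiply]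

/-- lower-right block embedding -/
noncomputable def blk2 {K : Type*} [Fintype K] [DecidableEq K] :
    SpecialLinearGroup K ℂ →* SpecialLinearGroup (Fin 2 ⊕ K) ℂ where
  toFun A := ⟨fromBlocks 1 0 0 A.1, by rw [Matrix.det_fromBlocks_zero₂₁, A.2]; simp⟩
  map_one' := by
    apply Subtype.ext
    show fromBlocks (1 : Matrix (Fin 2) (Fin 2) ℂ) 0 0 (1 : Matrix K K ℂ) = 1
    exact Matrix.fromBlocks_one
  map_mul' A B := by
    apply Subtype.ext
    show fromBlocks (1 : Matrix (Fin 2) (Fin 2) ℂ) 0 0 (A.1 * B.1) =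
      fromBlocks 1 0 0 A.1 * fromBlocks 1 0 0 B.1
    simp [Matrix.fromBlocks_multiply]

lemma blk_val {K : Type*} [Fintype K] [DecidableEq K] (A : S) :
    (blk A : SpecialLinearGroup (Fin 2 ⊕ K) ℂ).1 = fromBlocks A.1 0 0 1 := rfl

lemma blk2_val {K : Type*} [Fintype K] [DecidableEq K] (A : SpecialLinearGroup K ℂ) :
    (blk2 A : SpecialLinearGroup (Fin 2 ⊕ K) ℂ).1 = fromBlocks 1 0 0 A.1 := rfl

lemma blk_NC {K : Type*} [Fintype K] [DecidableEq K] :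
    NC NN (blk : S →* SpecialLinearGroup (Fin 2 ⊕ K) ℂ) := by
  intro A
  have ent : ∀ (h : S) i j, ‖h.1 i j‖ ≤ 1 + M h := by
    intro h i j
    have : ‖h.1 i j‖^2 ≤ M h := by
      unfold M al de
      have := sq_nonneg ‖h.1 0 0‖
      have := sq_nonneg ‖h.1 0 1‖
      have := sq_nonneg ‖h.1 1 0‖
      have := sq_nonneg ‖h.1 1 1‖
      fin_cases i <;> fin_cases j <;> simp <;> linarith
    nlinarith [sq_nonneg (‖h.1 i j‖ - 1)]
  have ent2 : ∀ (h : S) i j, ‖(blk h : SpecialLinearGroup (Fin 2 ⊕ K) ℂ).1 i j‖ ≤ 1 + M h := by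
    intro h i j
    have hp := M_pos h
    rw [blk_val]
    rcases i with i | i <;> rcases j with j | j
    · simpa using ent h i j
    · simp; linarith
    · simp; linarith
    · simp only [fromBlocks_apply₂₂, Matrix.one_apply]
      split_ifs <;> simp <;> linarith
  have nb : ∀ h : S, nrm (blk h : SpecialLinearGroup (Fin 2 ⊕ K) ℂ).1 ≤
      Fintype.card (Fin 2 ⊕ K) * (Fintype.card (Fin 2 ⊕ K) * (1 + M h)) := by
    intro h
    unfold nrm
    calc _ ≤ ∑ i : Fin 2 ⊕ K, ∑ j : Fin 2 ⊕ K, (1 + M h) := by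
          gcongr with i _ j _
          exact ent2 h i j
      _ = _ := by simp only [Finset.sum_const, Finset.card_univ, nsmul_eq_mul]
  set c : ℝ := (Fintype.card (Fin 2 ⊕ K) : ℝ)
  have hc : 0 ≤ c := Nat.cast_nonneg _
  refine ⟨max 1 (c * (c * (1 + A)) + c * (c * (1 + A))), le_max_left _ _, ?_⟩
  intro h hA
  refine le_trans ?_ (le_max_right _ _)
  unfold NN
  rw [← map_inv]
  have a1 := nb h
  have a2 := nb h⁻¹
  rw [M_inv] at a2
  have a3 : c * (c * (1 + M h)) ≤ c * (c * (1 + A)) := by gcongr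
  linarith

lemma blk_M {K : Type*} [Fintype K] [DecidableEq K] (C : ℝ) : ∃ B, ∀ h : S,
    NN (blk h : SpecialLinearGroup (Fin 2 ⊕ K) ℂ) ≤ C → M h ≤ B := by
  refine ⟨4 * C^2, ?_⟩
  intro h hC
  have ent : ∀ i j, ‖h.1 i j‖ ^ 2 ≤ C ^ 2 := by
    intro i j
    have := entry_le (blk h : SpecialLinearGroup (Fin 2 ⊕ K) ℂ).1 (Sum.inl i) (Sum.inl j)
    rw [blk_val] at this
    simp only [fromBlocks_apply₁₁] at this
    have h2 := nrm_nonneg ((blk h : SpecialLinearGroup (Fin 2 ⊕ K) ℂ)⁻¹).1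
    unfold NN at hC
    rw [blk_val] at hC
    have : ‖h.1 i j‖ ≤ C := by linarith
    gcongr
  unfold M al de
  linarith [ent 0 0, ent 0 1, ent 1 0, ent 1 1]

section
variable {m : ℕ}

/-- swap of the first two blocks -/
def sig1 (m : ℕ) : Equiv.Perm (Fin 2 ⊕ (Fin 2 ⊕ Fin m)) where
  toFun := Sum.elim (fun i => Sum.inr (Sum.inl i)) (Sum.elim (fun i => Sum.inl i) (fun k => Sum.inr (Sum.inr k)))
  invFun := Sum.elim (fun i => Sum.inr (Sum.inl i)) (Sum.elim (fun i => Sum.inl i) (fun k => Sum.inr (Sum.inr k)))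
  left_inv := by rintro (i | i | i) <;> rfl
  right_inv := by rintro (i | i | i) <;> rfl

lemma psi_conj : ∃ x : SpecialLinearGroup (Fin 2 ⊕ (Fin 2 ⊕ Fin m)) ℂ, ∀ A : S,
    blk2 (blk A) = x * blk A * x⁻¹ := by
  obtain ⟨x, hx⟩ := exists_perm (sig1 m)
  refine ⟨x, fun A => hx _ _ ?_⟩
  intro i j
  rw [blk2_val, blk_val, blk_val]
  rcases i with i | i | i <;> rcases j with j | j | j <;> simp [sig1, Matrix.one_apply]

/-- upper unipotent in `SL 2` -/
noncomputable def up (z : ℝ) : S := ⟨!![1, (z:ℂ); 0, 1], by simp [Matrix.det_fin_two]⟩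

lemma up_val (z : ℝ) : (up z).1 = !![1, (z:ℂ); 0, 1] := rfl

lemma M_up (z : ℝ) : M (up z) = 2 + z^2 := by
  unfold M al de
  rw [up_val]
  simp
  ring

/-- the unipotent -/
noncomputable def uu (m : ℕ) (z : ℝ) : SpecialLinearGroup (Fin 2 ⊕ (Fin 2 ⊕ Fin m)) ℂ :=
  ⟨fromBlocks 1 (Matrix.single 0 (Sum.inl 0) (z:ℂ)) 0 1, by
    rw [Matrix.det_fromBlocks_zero₂₁]; simp⟩

lemma uu_val (z : ℝ) :
    (uu m z).1 = fromBlocks 1 (Matrix.single 0 (Sum.inl 0) (z:ℂ)) 0 1 := rfl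

lemma uu_conj : ∃ x : SpecialLinearGroup (Fin 2 ⊕ (Fin 2 ⊕ Fin m)) ℂ, ∀ z : ℝ,
    uu m z = x * blk (up z) * x⁻¹ := by
  obtain ⟨x, hx⟩ := exists_perm (Equiv.swap (Sum.inl 1 : Fin 2 ⊕ (Fin 2 ⊕ Fin m)) (Sum.inr (Sum.inl 0)))
  refine ⟨x, fun z => hx _ _ ?_⟩
  intro i j
  rw [uu_val, blk_val, up_val]
  rcases i with i | i | i <;> rcases j with j | j | j <;> (try fin_cases i) <;> (try fin_cases j)
  all_goals simp [Equiv.swap_apply_def, Matrix.one_apply]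

/-- the centralizing torus -/
noncomputable def tt (m : ℕ) (r : ℝ) (hr : r ≠ 0) : SpecialLinearGroup (Fin 2 ⊕ (Fin 2 ⊕ Fin m)) ℂ :=
  ⟨fromBlocks ((r:ℂ) • 1) 0 0 (fromBlocks ((r:ℂ)⁻¹ • 1) 0 0 1), by
    have : (r:ℂ) ≠ 0 := by exact_mod_cast hr
    rw [Matrix.det_fromBlocks_zero₂₁, Matrix.det_fromBlocks_zero₂₁]
    simp [Matrix.det_smul]
    field_simp⟩

lemma tt_val (r : ℝ) (hr : r ≠ 0) : (tt m r hr).1 =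
   fromBlocks ((r:ℂ) • 1) 0 0 (fromBlocks ((r:ℂ)⁻¹ • 1) 0 0 1) := rfl

lemma tt_uu (r : ℝ) (hr : r ≠ 0) (z : ℝ) :
    tt m r hr * uu m z * (tt m r hr)⁻¹ = uu m (r^2 * z) := by
  rw [mul_inv_eq_iff_eq_mul]
  apply Subtype.ext
  show (tt m r hr).1 * (uu m z).1 = (uu m (r^2*z)).1 * (tt m r hr).1
  have : (r:ℂ) ≠ 0 := by exact_mod_cast hr
  rw [tt_val, uu_val, uu_val]
  simp only [Matrix.fromBlocks_multiply]
  congr 1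
  · simp
  · ext i j
    rcases j with j | j
    · simp [Matrix.mul_apply, Matrix.single_apply, Matrix.one_apply, Fintype.sum_sum_type]
      rw [ite_and]
      congr 2
      field_simp
    · simp [Matrix.mul_apply, Matrix.single_apply, Matrix.one_apply, Fintype.sum_sum_type]
  · simp
  · simp

theorem coreJ (Γ : Subgroup (SpecialLinearGroup (Fin 2 ⊕ (Fin 2 ⊕ Fin m)) ℂ))
    (hP : PP NN Γ blk) (hE : EE NN Γ blk) : False := by
  obtain ⟨x1, hx1⟩ := psi_conj (m := m)
  obtain ⟨x2, hx2⟩ := uu_conj (m := m)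
  have h1 : ∀ g : SpecialLinearGroup (Fin 2 ⊕ (Fin 2 ⊕ Fin m)) ℂ, 1 ≤ NN g := NN_one_le
  have hmul : ∀ a b : SpecialLinearGroup (Fin 2 ⊕ (Fin 2 ⊕ Fin m)) ℂ, NN (a * b) ≤ NN a * NN b :=
    NN_mul
  obtain ⟨c, -, hc⟩ := conj_NC h1 hmul (blk_NC (K := Fin 2 ⊕ Fin m)) x2 3
  refine core h1 hmul (φ := blk) (ψ := blk2.comp blk) ?_ hP ?_ blk_NC ?_ hE
    (conj_E h1 hmul hE x1 hx1) {t | ∃ r, ∃ hr : r ≠ 0, t = tt m r hr} ?_ ?_ (uu m) ?_ c ?_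
  · intro a b
    apply Subtype.ext
    show (blk a).1 * (blk2 (blk b)).1 = (blk2 (blk b)).1 * (blk a).1
    rw [blk2_val, blk_val]
    simp [Matrix.fromBlocks_multiply]
  · intro R
    obtain ⟨B, hB⟩ := conj_P h1 hmul hP x1 R
    refine ⟨B, fun γ hγ g h hg hg' => hB γ hγ g h hg ?_⟩
    rw [← hx1]; exact hg'
  · intro A
    obtain ⟨B, hB1, hB⟩ := conj_NC h1 hmul (blk_NC (K := Fin 2 ⊕ Fin m)) x1 A
    refine ⟨B, hB1, fun h hA => ?_⟩
    have := hB h hA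
    rw [← hx1] at this; exact this
  · rintro t ⟨r, hr, rfl⟩ a
    apply Subtype.ext
    show (tt m r hr).1 * (blk a).1 = (blk a).1 * (tt m r hr).1
    rw [tt_val, blk_val]
    simp [Matrix.fromBlocks_multiply]
  · rintro t ⟨r, hr, rfl⟩ a
    apply Subtype.ext
    show (tt m r hr).1 * (blk2 (blk a)).1 = (blk2 (blk a)).1 * (tt m r hr).1
    rw [tt_val, blk2_val, blk_val]
    simp [Matrix.fromBlocks_multiply]
  · intro R
    obtain ⟨B, hB⟩ := conj_P h1 hmul hP x2 R
    refine ⟨B, fun γ hγ g z hg hg' => ?_⟩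
    rw [hx2] at hg'
    have := hB γ hγ g _ hg hg'
    rw [M_up] at this
    nlinarith [sq_nonneg (z - 1)]
  · intro z
    have hpos : 0 < 1 + |z| := by positivity
    refine ⟨tt m (1 + |z|)⁻¹ (by positivity), ⟨_, _, rfl⟩, ?_⟩
    rw [tt_uu, hx2]
    apply hc
    rw [M_up]
    have h3 : |(1 + |z|)⁻¹ ^ 2 * z| ≤ 1 := by
      rw [abs_mul, abs_of_nonneg (by positivity), inv_pow, inv_mul_le_iff₀ (by positivity)]
      nlinarith [abs_nonneg z]
    have := (sq_le_one_iff_abs_le_one _).mpr h3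
    linarith

end

end Shalom

namespace Shalom

/-- reindexing of special linear groups -/
noncomputable def reix {I K : Type*} [Fintype I] [DecidableEq I] [Fintype K] [DecidableEq K]
    (e : I ≃ K) : SpecialLinearGroup I ℂ ≃* SpecialLinearGroup K ℂ where
  toFun A := ⟨A.1.submatrix e.symm e.symm, by rw [Matrix.det_submatrix_equiv_self]; exact A.2⟩
  invFun A := ⟨A.1.submatrix e e, by rw [Matrix.det_submatrix_equiv_self]; exact A.2⟩
  left_inv A := by apply Subtype.ext; simp
  right_inv A := by apply Subtype.ext; simp
  map_mul' A B := by
    apply Subtype.ext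
    show (A.1 * B.1).submatrix e.symm e.symm =
      A.1.submatrix e.symm e.symm * B.1.submatrix e.symm e.symm
    rw [Matrix.submatrix_mul_equiv]

section
variable {I K : Type*} [Fintype I] [DecidableEq I] [Fintype K] [DecidableEq K] (e : I ≃ K)

lemma reix_val (A : SpecialLinearGroup I ℂ) : (reix e A).1 = A.1.submatrix e.symm e.symm := rfl

lemma nrm_reix (A : Matrix I I ℂ) : nrm (A.submatrix e.symm e.symm) = nrm A := by
  unfold nrm
  simp only [Matrix.submatrix_apply]
  rw [Equiv.sum_comp e.symm (fun i => ∑ j, ‖A i (e.symm j)‖)]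
  refine Finset.sum_congr rfl (fun i _ => ?_)
  rw [Equiv.sum_comp e.symm (fun j => ‖A i j‖)]

lemma NN_reix (A : SpecialLinearGroup I ℂ) : NN (reix e A) = NN A := by
  unfold NN
  rw [← map_inv, reix_val, reix_val, nrm_reix, nrm_reix]

end

lemma cont_val (n : ℕ) : Continuous (fun g : SpecialLinearGroup (Fin n) ℂ => g.1) :=
  continuous_induced_dom

lemma cont_nrm (n : ℕ) : Continuous (fun A : Matrix (Fin n) (Fin n) ℂ => nrm A) := by
  unfold nrm
  refine continuous_finsetSum _ (fun i _ => continuous_finsetSum _ (fun j _ => ?_))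
  exact (continuous_id.matrix_elem i j).norm

lemma cont_NN (n : ℕ) : Continuous (fun g : SpecialLinearGroup (Fin n) ℂ => NN g) := by
  have e : (fun g : SpecialLinearGroup (Fin n) ℂ => NN g) = fun g => nrm g.1 + nrm (g.1.adjugate) := by
    funext g
    unfold NN
    rw [Matrix.SpecialLinearGroup.coe_inv]
  rw [e]
  exact ((cont_nrm n).comp (cont_val n)).add ((cont_nrm n).comp (cont_val n).matrix_adjugate)

lemma comp_NN (n : ℕ) (R : ℝ) : IsCompact {g : SpecialLinearGroup (Fin n) ℂ | NN g ≤ R} := by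
  have hemb : Topology.IsClosedEmbedding (fun g : SpecialLinearGroup (Fin n) ℂ => g.1) := by
    refine ⟨⟨⟨rfl⟩, fun a b h => Subtype.ext h⟩, ?_⟩
    have : Set.range (fun g : SpecialLinearGroup (Fin n) ℂ => g.1) =
        {A : Matrix (Fin n) (Fin n) ℂ | A.det = 1} := by
      ext A
      constructor
      · rintro ⟨g, rfl⟩
        exact g.2
      · intro h
        exact ⟨⟨A, h⟩, rfl⟩
    rw [this]
    exact isClosed_eq (continuous_id.matrix_det) continuous_const
  have hbox : IsCompact (Set.univ.pi (fun _ : Fin n => Set.univ.pi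
      (fun _ : Fin n => Metric.closedBall (0:ℂ) R))) :=
    isCompact_univ_pi (fun _ => isCompact_univ_pi (fun _ => isCompact_closedBall _ _))
  have h2 := hemb.isCompact_preimage hbox
  refine h2.of_isClosed_subset (isClosed_le (cont_NN n) continuous_const) ?_
  intro g hg i _ j _
  rw [mem_closedBall_zero_iff]
  have h3 := entry_le g.1 i j
  have h4 := nrm_nonneg (g⁻¹).1
  have h5 : NN g ≤ R := hg
  unfold NN at h5
  linarith

end Shalom

open Shalom in
theorem shalom_no_compact_form_complex (n : ℕ) (hn : 4 ≤ n)
    (H : Subgroup (Matrix.SpecialLinearGroup (Fin n) ℂ))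
    (hH : (H : Set (Matrix.SpecialLinearGroup (Fin n) ℂ)) =
      {g : Matrix.SpecialLinearGroup (Fin n) ℂ | ∀ i j : Fin n,
        (2 ≤ (i : ℕ) ∨ 2 ≤ (j : ℕ)) →
        (g : Matrix (Fin n) (Fin n) ℂ) i j = if i = j then 1 else 0})
    (Γ : Subgroup (Matrix.SpecialLinearGroup (Fin n) ℂ))
    (hdisc : DiscreteTopology Γ) :
    ¬ ((∀ γ : Γ, (∃ x : Matrix.SpecialLinearGroup (Fin n) ℂ ⧸ H,
          (γ : Matrix.SpecialLinearGroup (Fin n) ℂ) • x = x) → γ = 1) ∧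
        (∀ K L : Set (Matrix.SpecialLinearGroup (Fin n) ℂ ⧸ H),
          IsCompact K → IsCompact L →
          {γ : Γ | ∃ x ∈ K, ((γ : Matrix.SpecialLinearGroup (Fin n) ℂ) • x) ∈ L}.Finite) ∧
        (∃ K : Set (Matrix.SpecialLinearGroup (Fin n) ℂ ⧸ H), IsCompact K ∧
          ∀ x : Matrix.SpecialLinearGroup (Fin n) ℂ ⧸ H, ∃ γ ∈ Γ, ∃ y ∈ K, γ • y = x)) := by
  rintro ⟨-, hpd, hco⟩
  obtain ⟨m, rfl⟩ : ∃ m, n = 2 + (2 + m) := ⟨n - 4, by omega⟩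
  have : IsTopologicalGroup (Matrix.SpecialLinearGroup (Fin (2 + (2 + m))) ℂ) :=
    Matrix.SpecialLinearGroup.topologicalGroup
  let e : Fin 2 ⊕ (Fin 2 ⊕ Fin m) ≃ Fin (2 + (2 + m)) :=
    (Equiv.sumCongr (Equiv.refl _) finSumFinEquiv).trans finSumFinEquiv
  have e_inl : ∀ i, ((e (Sum.inl i)) : ℕ) = i := by intro i; simp [e]
  have e_inr : ∀ k, 2 ≤ ((e (Sum.inr k)) : ℕ) := by intro k; simp [e]
  let φ : S →* Matrix.SpecialLinearGroup (Fin (2 + (2 + m))) ℂ := (reix e).toMonoidHom.comp blk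
  have φ_def : ∀ h, φ h = reix e (blk h) := fun h => rfl
  have memH : ∀ g, g ∈ H ↔ ∀ i j : Fin (2 + (2 + m)), (2 ≤ (i : ℕ) ∨ 2 ≤ (j : ℕ)) →
        g.1 i j = if i = j then 1 else 0 := by
    intro g
    have : g ∈ H ↔ g ∈ (H : Set _) := Iff.rfl
    rw [this, hH]
    rfl
  have hφH : ∀ h, φ h ∈ H := by
    intro h
    rw [memH]
    intro i j hij
    rw [φ_def, reix_val, blk_val, Matrix.submatrix_apply]
    obtain ⟨i, rfl⟩ := e.surjective i
    obtain ⟨j, rfl⟩ := e.surjective j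
    rw [e.symm_apply_apply, e.symm_apply_apply]
    simp only [e.apply_eq_iff_eq]
    rcases i with i | i <;> rcases j with j | j
    · rw [e_inl, e_inl] at hij
      omega
    · simp
    · simp
    · simp [Matrix.one_apply]
  have hHφ : ∀ x ∈ H, ∃ h, φ h = x := by
    intro x hx
    rw [memH] at hx
    have hy : (x.1).submatrix e e = fromBlocks ((x.1).submatrix e e).toBlocks₁₁ 0 0 1 := by
      ext i j
      rcases i with i | i <;> rcases j with j | j
      · simp [Matrix.toBlocks₁₁]
      · rw [Matrix.submatrix_apply, hx _ _ (Or.inr (e_inr j))]; simp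
      · rw [Matrix.submatrix_apply, hx _ _ (Or.inl (e_inr i))]; simp
      · rw [Matrix.submatrix_apply, hx _ _ (Or.inl (e_inr i))]; simp [Matrix.one_apply]
    have hdet : (((x.1).submatrix e e).toBlocks₁₁).det = 1 := by
      have h2 : ((x.1).submatrix e e).det = 1 := by
        rw [Matrix.det_submatrix_equiv_self]; exact x.2
      rw [hy, Matrix.det_fromBlocks_zero₂₁] at h2
      simpa using h2
    obtain ⟨k, hk⟩ : ∃ k : S, k.1 = ((x.1).submatrix e e).toBlocks₁₁ := ⟨⟨_, hdet⟩, rfl⟩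
    refine ⟨k, ?_⟩
    rw [φ_def]
    apply Subtype.ext
    rw [reix_val, blk_val, hk, ← hy]
    simp
  have hP : PP NN Γ φ := topo_P NN_one_le NN_mul NN_inv (comp_NN _) H φ hφH (by
    intro C
    obtain ⟨B, hB⟩ := blk_M (K := Fin 2 ⊕ Fin m) C
    refine ⟨B, fun h hh => hB h ?_⟩
    rwa [φ_def, NN_reix] at hh) hpd
  have hE : EE NN Γ φ := topo_E (cont_NN _) H φ hHφ hco
  refine coreJ (m := m) (Γ.comap (reix e).toMonoidHom) ?_ ?_
  · intro R
    obtain ⟨B, hB⟩ := hP R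
    refine ⟨B, fun γ hγ g h hg hg' => hB (reix e γ) hγ (reix e g) h ?_ ?_⟩
    · rwa [NN_reix]
    · rw [φ_def, ← map_mul, ← map_mul, NN_reix]; exact hg'
  · obtain ⟨R, hR⟩ := hE
    refine ⟨R, fun g => ?_⟩
    obtain ⟨γ, hγ, h, hh⟩ := hR (reix e g)
    refine ⟨(reix e).symm γ, ?_, h, ?_⟩
    · show reix e ((reix e).symm γ) ∈ Γ
      rw [MulEquiv.apply_symm_apply]; exact hγ
    · rw [← NN_reix e, map_mul, map_mul, MulEquiv.apply_symm_apply]; exact hh
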